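/- arXiv:2201.12505 — 9 statements merged into one kernel-verified Lean document; each statement's English description precedes it below -/
import Mathlib

section
/- Let m ≥ 3 and let λ be a 2×m integer matrix that is nonsingular for the m-gon. Then Σ_{j=1}^m l_j ≡ m (mod 2). -/
open Finset

/-- On pairs of rows spanning `(ZMod 2)²`, this is the sign of the corresponding permutation of the
three nonzero vectors. -/
def pairSign (a b c d : ZMod 2) : ZMod 2 := (b + c + b * c) * (1 + a + d)

/-- For consecutive bases of `(ZMod 2)²`, the outer determinant records whether the sign changes. -/
lemma outer_det_eq_one_add_pairSign : ∀ a b c d e f : ZMod 2,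
    a * d - c * b = 1 → c * f - e * d = 1 →
      e * b - a * f = 1 + (pairSign c d e f - pairSign a b c d) := by
  unfold pairSign
  decide

/-- For a characteristic matrix `lam` over the `m`-gon,
`∑ⱼ lⱼ ≡ m (mod 2)`. -/
theorem stmt_1 (m : ℕ) [NeZero m] (hm : 3 ≤ m)
    (lam : Fin 2 → ZMod m → ℤ)
    (Δ : ZMod m → ZMod m → ℤ)
    (hΔ : ∀ i j, Δ i j = lam 0 i * lam 1 j - lam 0 j * lam 1 i)
    (l : ZMod m → ℤ)
    (hl : ∀ i, l i = Δ (i - 1) i * Δ i (i + 1) * Δ (i + 1) (i - 1))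
    (hns : ∀ i, Δ i (i + 1) = 1 ∨ Δ i (i + 1) = -1) :
    (∑ j : ZMod m, l j) ≡ (m : ℤ) [ZMOD 2] := by
  have hadj : ∀ i, ((Δ i (i + 1) : ℤ) : ZMod 2) = 1 := fun i => by
    rcases hns i with h | h <;> rw [h] <;> decide
  have hprev : ∀ i, ((Δ (i - 1) i : ℤ) : ZMod 2) = 1 := fun i => by
    simpa using hadj (i - 1)
  let g : ZMod m → ZMod 2 := fun i =>
    pairSign (lam 0 i) (lam 1 i) (lam 0 (i + 1)) (lam 1 (i + 1))
  have key : ∀ i, ((l i : ℤ) : ZMod 2) = 1 + (g i - g (i - 1)) := fun i => by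
    have h₁ := hprev i
    have h₂ := hadj i
    rw [hl, Int.cast_mul, Int.cast_mul, h₁, h₂, one_mul, one_mul, hΔ]
    rw [hΔ] at h₁ h₂
    push_cast at h₁ h₂ ⊢
    simpa only [g, sub_add_cancel] using outer_det_eq_one_add_pairSign _ _ _ _ _ _ h₁ h₂
  have hshift : ∑ i, g (i - 1) = ∑ i, g i := Equiv.sum_comp (Equiv.subRight (1 : ZMod m)) g
  refine (ZMod.intCast_eq_intCast_iff _ _ 2).mp ?_
  rw [Int.cast_sum, sum_congr rfl fun i _ => key i, sum_add_distrib, sum_sub_distrib, hshift]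
  simp [ZMod.card]
end

section
/- Let m ≥ 3 and let λ be a 2×m integer matrix that is nonsingular for the m-gon such that every column sum λ_{1,j} + λ_{2,j} is odd. Then Σ_{i=1}^m l_i = 0. (This is the combinatorial content of the statement that every 4-dimensional spin quasitoric manifold is string: the spin condition on M(C₂(m),λ) is that all column sums of λ are odd, and the string condition p₁ = 0 is Σ l_i = 0.) -/
open Finset

/-- If every vertex `v` of a graph has at most one neighbour of smaller height and the height is
never constant along an edge, then a turning function `L u v w` that is additive at every vertex
sums to zero along each closed walk. -/
theorem sum_turning_eq_zero {A : Type*} (E : A → A → Prop) (μ : A → ℕ) (L : A → A → A → ℤ)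
    (symm : ∀ v w, E v w → E w v)
    (ne : ∀ v w, E v w → μ v ≠ μ w)
    (uniq : ∀ v u w, E v u → E v w → μ u < μ v → μ w < μ v → u = w)
    (L_add : ∀ v u w x, E v u → E v w → E v x → L u v w + L w v x = L u v x)
    {m : ℕ} [NeZero m] (a : ZMod m → A) (ha : ∀ i, E (a i) (a (i + 1))) :
    ∑ i, L (a (i - 1)) (a i) (a (i + 1)) = 0 := by
  classical
  have exists_parent : ∀ v, ∃ u, (∃ w, E v w) → E v u ∧ ∀ w, E v w → μ u ≤ μ w := by
    intro v
    by_cases h : ∃ w, E v w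
    · exact ⟨Function.argminOn μ {w | E v w} h, fun _ =>
        ⟨Function.argminOn_mem μ {w | E v w} h, fun w hw => Function.argminOn_le μ _ hw⟩⟩
    · exact ⟨v, fun h' => absurd h' h⟩
  choose p hp using exists_parent
  have parent_eq : ∀ v w, E v w → μ v < μ w → p w = v := fun v w hvw hlt =>
    have h := hp w ⟨v, symm _ _ hvw⟩
    uniq w _ _ h.1 (symm _ _ hvw) ((h.2 v (symm _ _ hvw)).trans_lt hlt) hlt
  obtain ⟨g, hg⟩ : ∃ g : A → ℤ, ∀ v, μ (p v) < μ v →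
      g v = g (p v) + L (p (p v)) (p v) v := by
    let F : (v : A) → ((w : A) → μ w < μ v → ℤ) → ℤ := fun v ih =>
      if h : μ (p v) < μ v then ih (p v) h + L (p (p v)) (p v) v else 0
    refine ⟨(measure μ).wf.fix F, fun v hv => ?_⟩
    rw [WellFounded.fix_eq]
    exact dif_pos hv
  have loop : ∀ u v, E v u → L u v u = 0 := fun u v h => by
    have := L_add v u u u h h h
    linarith
  have of_lt : ∀ v w, E v w → μ v < μ w → L (p v) v w - L (p w) w v = g w - g v := by
    intro v w h hlt
    have hpw := parent_eq v w h hlt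
    have hgw := hg w (hpw ▸ hlt)
    rw [hpw] at hgw ⊢
    rw [loop v w (symm _ _ h)]
    linarith
  have edge : ∀ v w, E v w → L (p v) v w - L (p w) w v = g w - g v := by
    intro v w h
    rcases (ne v w h).lt_or_gt with hlt | hlt
    · exact of_lt v w h hlt
    · have := of_lt w v (symm _ _ h) hlt
      linarith
  have term : ∀ i, L (a (i - 1)) (a i) (a (i + 1)) =
      L (p (a i)) (a i) (a (i + 1)) - L (p (a i)) (a i) (a (i - 1)) := by
    intro i
    have h₁ : E (a i) (a (i - 1)) := symm _ _ (by simpa using ha (i - 1))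
    have h₂ := (hp (a i) ⟨_, ha i⟩).1
    have := L_add _ _ _ _ h₂ h₁ (ha i)
    linarith
  have shift : ∑ i, L (p (a i)) (a i) (a (i - 1)) =
      ∑ i, L (p (a (i + 1))) (a (i + 1)) (a i) := by
    rw [← Equiv.sum_comp (Equiv.addRight (1 : ZMod m))]
    simp
  have shift_g : ∑ i, g (a (i + 1)) = ∑ i, g (a i) :=
    Equiv.sum_comp (Equiv.addRight (1 : ZMod m)) fun i => g (a i)
  rw [sum_congr rfl fun i _ => term i, sum_sub_distrib, shift, ← sum_sub_distrib,
    sum_congr rfl fun i _ => edge _ _ (ha i), sum_sub_distrib, shift_g, sub_self]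

/-- The determinant of two integer vectors. -/
def vecDet (v w : ℤ × ℤ) : ℤ := v.1 * w.2 - w.1 * v.2

/-- The representative of `{v, -v}` that is lexicographically nonnegative. -/
def signNormal (v : ℤ × ℤ) : ℤ × ℤ := if 0 < v.1 ∨ (v.1 = 0 ∧ 0 ≤ v.2) then v else -v

theorem signNormal_eq_or (v : ℤ × ℤ) : signNormal v = v ∨ signNormal v = -v := by
  unfold signNormal
  split_ifs <;> simp

theorem signNormal_neg (v : ℤ × ℤ) : signNormal (-v) = signNormal v := by
  obtain ⟨x, y⟩ := v
  unfold signNormal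
  split_ifs <;> simp_all [Prod.ext_iff] <;> omega

theorem signNormal_signNormal (v : ℤ × ℤ) : signNormal (signNormal v) = signNormal v := by
  rcases signNormal_eq_or v with h | h
  · rw [h, h]
  · rw [h, signNormal_neg, h]

/-- Adjacency of sign-normalized vectors with odd coordinate sum: determinant `±1`. -/
def OddFareyAdj (v w : ℤ × ℤ) : Prop :=
  (signNormal v = v ∧ Odd (v.1 + v.2)) ∧ (signNormal w = w ∧ Odd (w.1 + w.2)) ∧
    (vecDet v w = 1 ∨ vecDet v w = -1)

/-- A norm on `ℤ²` whose parity is that of the first coordinate. -/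
def vecHeight (v : ℤ × ℤ) : ℕ := v.1.natAbs + 2 * v.2.natAbs

theorem vecDet_swap (v w : ℤ × ℤ) : vecDet w v = -vecDet v w := by
  unfold vecDet; ring

theorem OddFareyAdj.symm {v w : ℤ × ℤ} (h : OddFareyAdj v w) : OddFareyAdj w v := by
  obtain ⟨hv, hw, h⟩ := h
  refine ⟨hw, hv, ?_⟩
  rw [vecDet_swap]
  omega

theorem OddFareyAdj.odd_fst_add {v w : ℤ × ℤ} (h : OddFareyAdj v w) : Odd (v.1 + w.1) := by
  obtain ⟨⟨-, hv⟩, ⟨-, hw⟩, h⟩ := h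
  have hd : Odd (vecDet v w) := by rcases h with h | h <;> rw [h] <;> decide
  unfold vecDet at hd
  simp only [← Int.not_even_iff_odd, Int.even_add, Int.even_sub, Int.even_mul] at *
  tauto

theorem OddFareyAdj.vecHeight_ne {v w : ℤ × ℤ} (h : OddFareyAdj v w) :
    vecHeight v ≠ vecHeight w := by
  have := h.odd_fst_add
  unfold vecHeight
  grind

theorem eq_of_two_mul {v u w : ℤ × ℤ} {k : ℤ} (hu : vecHeight u < vecHeight v)
    (hw : vecHeight w < vecHeight v) (h₁ : w.1 - u.1 = 2 * k * v.1)
    (h₂ : w.2 - u.2 = 2 * k * v.2) : w = u := by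
  rcases eq_or_ne k 0 with rfl | hk
  · ext <;> linarith
  · exfalso
    have hle : ∀ x : ℤ, 2 * x.natAbs ≤ (2 * k * x).natAbs := fun x => by
      rw [Int.natAbs_mul]
      exact Nat.mul_le_mul_right _ (by omega)
    have e₁ := hle v.1
    have e₂ := hle v.2
    rw [← h₁] at e₁
    rw [← h₂] at e₂
    unfold vecHeight at hu hw
    omega

theorem exists_two_mul_of_vecDet_eq {v u w : ℤ × ℤ} (hd : vecDet v u = 1 ∨ vecDet v u = -1)
    (h₁ : Even (w.1 - u.1)) (h₂ : Even (w.2 - u.2)) (h : vecDet v w = vecDet v u) :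
    ∃ k : ℤ, w.1 - u.1 = 2 * k * v.1 ∧ w.2 - u.2 = 2 * k * v.2 := by
  have hsq : vecDet v u * vecDet v u = 1 := by rcases hd with hd | hd <;> rw [hd] <;> rfl
  obtain ⟨s, hs⟩ := h₁
  obtain ⟨t, ht⟩ := h₂
  have hst : v.1 * t = s * v.2 := by
    unfold vecDet at h
    have : v.1 * (w.2 - u.2) = (w.1 - u.1) * v.2 := by linear_combination h
    rw [hs, ht] at this
    linarith
  refine ⟨vecDet v u * (s * u.2 - u.1 * t), ?_, ?_⟩
  · have : s = vecDet v u * (s * u.2 - u.1 * t) * v.1 := by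
      have : (s * u.2 - u.1 * t) * v.1 = s * vecDet v u := by
        unfold vecDet; linear_combination -u.1 * hst
      linear_combination -s * hsq - vecDet v u * this
    linear_combination hs + 2 * this
  · have : t = vecDet v u * (s * u.2 - u.1 * t) * v.2 := by
      have : (s * u.2 - u.1 * t) * v.2 = t * vecDet v u := by
        unfold vecDet; linear_combination -u.2 * hst
      linear_combination -t * hsq - vecDet v u * this
    linear_combination ht + 2 * this

theorem vecDet_neg_left (v w : ℤ × ℤ) : vecDet (-v) w = -vecDet v w := by
  simp [vecDet]; ring

theorem vecDet_neg_right (v w : ℤ × ℤ) : vecDet v (-w) = -vecDet v w := by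
  simp [vecDet]; ring

theorem OddFareyAdj.eq_of_vecHeight_lt {v u w : ℤ × ℤ} (hu : OddFareyAdj v u)
    (hw : OddFareyAdj v w) (hu' : vecHeight u < vecHeight v) (hw' : vecHeight w < vecHeight v) :
    u = w := by
  have hu₁ := hu.odd_fst_add
  have hw₁ := hw.odd_fst_add
  obtain ⟨-, ⟨u_normal, u_odd⟩, hdu⟩ := hu
  obtain ⟨-, ⟨w_normal, w_odd⟩, hdw⟩ := hw
  have h₁ : Even (w.1 - u.1) := by grind
  have h₂ : Even (w.2 - u.2) := by grind
  by_cases h : vecDet v w = vecDet v u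
  · obtain ⟨k, hk₁, hk₂⟩ := exists_two_mul_of_vecDet_eq hdu h₁ h₂ h
    exact (eq_of_two_mul hu' hw' hk₁ hk₂).symm
  · have hneg : vecDet v (-u) = -vecDet v u := vecDet_neg_right v u
    have e₁ : Even (w.1 - (-u).1) := by rw [Prod.fst_neg]; grind
    have e₂ : Even (w.2 - (-u).2) := by rw [Prod.snd_neg]; grind
    obtain ⟨k, hk₁, hk₂⟩ :=
      exists_two_mul_of_vecDet_eq (v := v) (u := -u) (by omega) e₁ e₂ (by omega)
    have hwu : w = -u := eq_of_two_mul (by simpa [vecHeight] using hu') hw' hk₁ hk₂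
    rw [← u_normal, ← w_normal, hwu, signNormal_neg]

theorem OddFareyAdj.turning_add {v u w x : ℤ × ℤ} (hu : OddFareyAdj v u)
    (hw : OddFareyAdj v w) (hx : OddFareyAdj v x) :
    vecDet u v * vecDet v w * vecDet w u + vecDet w v * vecDet v x * vecDet x w =
      vecDet u v * vecDet v x * vecDet x u := by
  have plucker : vecDet v x * vecDet w u + vecDet v w * -vecDet x u +
      vecDet v u * vecDet x w = 0 := by
    unfold vecDet; ring
  rw [vecDet_swap v u, vecDet_swap v w]
  rcases hu.2.2 with a | a <;> rcases hw.2.2 with b | b <;> rcases hx.2.2 with c | c <;>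
    simp only [a, b, c] at plucker ⊢ <;> linarith

theorem turning_signNormal (u v w : ℤ × ℤ) :
    vecDet (signNormal u) (signNormal v) * vecDet (signNormal v) (signNormal w) *
      vecDet (signNormal w) (signNormal u) = vecDet u v * vecDet v w * vecDet w u := by
  rcases signNormal_eq_or u with a | a <;> rcases signNormal_eq_or v with b | b <;>
    rcases signNormal_eq_or w with c | c <;> rw [a, b, c] <;>
    simp only [vecDet_neg_left, vecDet_neg_right] <;> ring

theorem odd_signNormal {v : ℤ × ℤ} (h : Odd (v.1 + v.2)) :
    Odd ((signNormal v).1 + (signNormal v).2) := by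
  rcases signNormal_eq_or v with a | a <;> rw [a]
  · exact h
  · simp only [Prod.fst_neg, Prod.snd_neg]
    grind

theorem oddFareyAdj_signNormal {v w : ℤ × ℤ} (hv : Odd (v.1 + v.2)) (hw : Odd (w.1 + w.2))
    (h : vecDet v w = 1 ∨ vecDet v w = -1) : OddFareyAdj (signNormal v) (signNormal w) := by
  refine ⟨⟨signNormal_signNormal v, odd_signNormal hv⟩,
    ⟨signNormal_signNormal w, odd_signNormal hw⟩, ?_⟩
  rcases signNormal_eq_or v with a | a <;> rcases signNormal_eq_or w with b | b <;>
    simp only [a, b, vecDet_neg_left, vecDet_neg_right] <;> omega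

/-- For a characteristic matrix over the `m`-gon all of whose column sums
are odd (the spin condition), `∑ᵢ lᵢ = 0` (the string condition `p₁ = 0`). -/
theorem stmt_2 (m : ℕ) [NeZero m] (hm : 3 ≤ m)
    (lam : Fin 2 → ZMod m → ℤ)
    (Δ : ZMod m → ZMod m → ℤ)
    (hΔ : ∀ i j, Δ i j = lam 0 i * lam 1 j - lam 0 j * lam 1 i)
    (l : ZMod m → ℤ)
    (hl : ∀ i, l i = Δ (i - 1) i * Δ i (i + 1) * Δ (i + 1) (i - 1))
    (hns : ∀ i, Δ i (i + 1) = 1 ∨ Δ i (i + 1) = -1)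
    (hodd : ∀ j, Odd (lam 0 j + lam 1 j)) :
    (∑ i : ZMod m, l i) = 0 := by
  let col : ZMod m → ℤ × ℤ := fun j => (lam 0 j, lam 1 j)
  have hdet : ∀ i j, Δ i j = vecDet (col i) (col j) := hΔ
  rw [← sum_turning_eq_zero OddFareyAdj vecHeight
    (fun u v w => vecDet u v * vecDet v w * vecDet w u)
    (fun _ _ h => h.symm) (fun _ _ h => h.vecHeight_ne)
    (fun _ _ _ hu hw => hu.eq_of_vecHeight_lt hw)
    (fun _ _ _ _ hu hw hx => hu.turning_add hw hx) (fun i => signNormal (col i))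
    fun i => oddFareyAdj_signNormal (hodd i) (hodd (i + 1)) (hdet i (i + 1) ▸ hns i)]
  refine sum_congr rfl fun i _ => ?_
  rw [hl, hdet, hdet, hdet]
  exact (turning_signNormal _ _ _).symm
end

section
/- Let m ≥ 3. There exists a 2×m integer matrix λ that is nonsingular for the m-gon, has every column sum λ_{1,j} + λ_{2,j} odd, and satisfies Σ_{i=1}^m l_i = 0, if and only if m is even. (This is the combinatorial content of the statement that the m-gon C₂(m) is the orbit polytope of a string quasitoric manifold if and only if C₂(m) is 2-colorable, i.e. m is even.) -/
open Finset

/-- If two integer columns have odd sums and determinant `±1`, their first entries differ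
in parity. -/
theorem even_iff_not_even_of_det {a b c d : ℤ} (h : a * d - c * b = 1 ∨ a * d - c * b = -1)
    (hab : Odd (a + b)) (hcd : Odd (c + d)) : Even c ↔ ¬ Even a := by
  have hdet : Odd (a * d - c * b) := by rcases h with h | h <;> rw [h] <;> decide
  simp only [← Int.not_even_iff_odd, Int.even_add, Int.even_sub, Int.even_mul] at hab hcd hdet
  tauto

/-- A cyclic integer sequence whose parity alternates has even period. -/
theorem even_period_of_alternating (m : ℕ) (f : ZMod m → ℤ)
    (hf : ∀ i, Even (f (i + 1)) ↔ ¬ Even (f i)) : Even m := by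
  have key (k : ℕ) : Even (f k) ↔ (Even k ↔ Even (f 0)) := by
    induction k with
    | zero => simp
    | succ k ih =>
      rw [Nat.cast_succ, hf, ih, Nat.even_add_one]
      tauto
  have hm := key m
  rw [ZMod.natCast_self] at hm
  tauto

/-- There exists a characteristic matrix over the `m`-gon with all column
sums odd and `∑ᵢ lᵢ = 0` (a string quasitoric manifold over `C₂(m)`) iff `m` is even. -/
theorem stmt_3 (m : ℕ) [NeZero m] (hm : 3 ≤ m) :
    (∃ lam : Fin 2 → ZMod m → ℤ,
      (∀ i : ZMod m,
        lam 0 i * lam 1 (i + 1) - lam 0 (i + 1) * lam 1 i = 1 ∨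
        lam 0 i * lam 1 (i + 1) - lam 0 (i + 1) * lam 1 i = -1) ∧
      (∀ j : ZMod m, Odd (lam 0 j + lam 1 j)) ∧
      (∑ i : ZMod m,
          (lam 0 (i - 1) * lam 1 i - lam 0 i * lam 1 (i - 1)) *
            (lam 0 i * lam 1 (i + 1) - lam 0 (i + 1) * lam 1 i) *
            (lam 0 (i + 1) * lam 1 (i - 1) - lam 0 (i - 1) * lam 1 (i + 1)) = 0))
    ↔ Even m := by
  constructor
  · rintro ⟨lam, hdet, hodd, -⟩
    exact even_period_of_alternating m (lam 0) fun i =>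
      even_iff_not_even_of_det (hdet i) (hodd i) (hodd (i + 1))
  · intro h
    let φ := ZMod.castHom h.two_dvd (ZMod 2)
    let g : Fin 2 → ZMod 2 → ℤ := fun r x => if (r.val : ZMod 2) = x then 1 else 0
    refine ⟨fun r j => g r (φ j), fun i => ?_, fun j => ?_, Finset.sum_eq_zero fun i _ => ?_⟩
    · simp only [map_add, map_one]
      generalize φ i = x
      revert x
      decide
    · change Odd (g 0 (φ j) + g 1 (φ j))
      generalize φ j = x
      revert x
      decide
    · simp only [map_add, map_sub, map_one]
      generalize φ i = x
      revert x
      decide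
end

section
/- Let m ≥ 3 and let λ be a 2×m integer matrix that is nonsingular for the m-gon. Then Σ_{j=1}^m v_j² lies in the ideal I + J of ℤ[v₁,…,v_m] (equivalently, p₁(M(C₂(m),λ)) = 0) if and only if Σ_{i=1}^m l_i = 0. -/
open MvPolynomial Finset

/-- A function on `ZMod m` invariant under the shift by one is constant. -/
theorem ZMod.eq_of_forall_add_one_eq {m : ℕ} [NeZero m] {α : Type*} {f : ZMod m → α}
    (h : ∀ i, f (i + 1) = f i) (i : ZMod m) : f i = f 0 := by
  obtain ⟨n, rfl⟩ := ZMod.natCast_zmod_surjective i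
  induction n with
  | zero => simp
  | succ k ih => rw [Nat.cast_succ, h, ih]

theorem ZMod.one_ne_zero_of_three_le {m : ℕ} (hm : 3 ≤ m) : (1 : ZMod m) ≠ 0 := by
  have : Fact (1 < m) := ⟨by lia⟩
  exact one_ne_zero

theorem ZMod.one_add_one_ne_zero_of_three_le {m : ℕ} (hm : 3 ≤ m) : (1 + 1 : ZMod m) ≠ 0 := by
  intro h
  have h2 : ((2 : ℕ) : ZMod m) = 0 := by
    push_cast
    rw [← one_add_one_eq_two, h]
  have := Nat.le_of_dvd (by simp) ((ZMod.natCast_eq_zero_iff 2 m).1 h2)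
  lia

/-- A sum over `ZMod m` supported on `{j - 1, j, j + 1}`. -/
theorem ZMod.sum_eq_of_support_neighbours {m : ℕ} [NeZero m] (hm : 3 ≤ m) {R : Type*}
    [AddCommMonoid R] (f : ZMod m → R) (j : ZMod m)
    (h : ∀ k, j ≠ k → k - j ≠ 1 → j - k ≠ 1 → f k = 0) :
    ∑ k, f k = f (j - 1) + (f j + f (j + 1)) := by
  have h1 := ZMod.one_ne_zero_of_three_le hm
  have h2 := ZMod.one_add_one_ne_zero_of_three_le hm
  rw [← Finset.sum_subset (Finset.subset_univ {j - 1, j, j + 1})]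
  · rw [Finset.sum_insert, Finset.sum_insert, Finset.sum_singleton]
    · simpa using h1
    · simp only [Finset.mem_insert, Finset.mem_singleton, sub_eq_self, h1, false_or]
      intro h3
      apply h2
      linear_combination -h3
  · intro k _ hk
    simp only [Finset.mem_insert, Finset.mem_singleton, not_or] at hk
    refine h k (fun e => hk.2.1 e.symm) (fun e => hk.2.2 ?_) (fun e => hk.1 ?_)
    · linear_combination e
    · linear_combination -e

/-- If `x` satisfies the defining relations of the face-ring quotient, then every `x j ^ 2` is
the multiple `l j` of a fixed element. -/
theorem exists_sq_eq_intCast_mul {m : ℕ} [NeZero m] (hm : 3 ≤ m) {R : Type*} [CommRing R]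
    (a b : ZMod m → ℤ) (hns : ∀ i, (a i * b (i + 1) - a (i + 1) * b i) ^ 2 = 1)
    (x : ZMod m → R) (hI : ∀ i j, i ≠ j → j - i ≠ 1 → i - j ≠ 1 → x i * x j = 0)
    (ha : ∑ j, (a j : R) * x j = 0) (hb : ∑ j, (b j : R) * x j = 0) :
    ∃ w : R, ∀ j, x j ^ 2 =
      (((a (j - 1) * b j - a j * b (j - 1)) * (a j * b (j + 1) - a (j + 1) * b j) *
        (a (j + 1) * b (j - 1) - a (j - 1) * b (j + 1)) : ℤ) : R) * w := by
  have key (c : ZMod m → ℤ) (hc : ∑ j, (c j : R) * x j = 0) (j : ZMod m) :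
      (c (j - 1) : R) * (x (j - 1) * x j) + (c j * x j ^ 2 + c (j + 1) * (x j * x (j + 1))) = 0 := by
    have h := ZMod.sum_eq_of_support_neighbours hm (fun k => x j * ((c k : R) * x k)) j
      (fun k h1 h2 h3 => by
        rw [mul_left_comm, hI j k h1 h2 h3, mul_zero])
    rw [← Finset.mul_sum, hc, mul_zero] at h
    linear_combination -h
  have hsq (j : ZMod m) : ((a j : R) * b (j + 1) - a (j + 1) * b j) ^ 2 = 1 := by
    exact_mod_cast congrArg (Int.cast : ℤ → R) (hns j)
  have hstep (j : ZMod m) :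
      ((a (j + 1) : R) * b (j + 1 + 1) - a (j + 1 + 1) * b (j + 1)) * (x (j + 1) * x (j + 1 + 1)) =
        ((a j : R) * b (j + 1) - a (j + 1) * b j) * (x j * x (j + 1)) := by
    have h1 := key a ha (j + 1)
    have h2 := key b hb (j + 1)
    rw [add_sub_cancel_right] at h1 h2
    linear_combination (a (j + 1) : R) * h2 - (b (j + 1) : R) * h1
  have hconst := ZMod.eq_of_forall_add_one_eq
    (f := fun j => ((a j : R) * b (j + 1) - a (j + 1) * b j) * (x j * x (j + 1))) hstep
  refine ⟨(a 0 * b (0 + 1) - a (0 + 1) * b 0) * (x 0 * x (0 + 1)), fun j => ?_⟩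
  rw [← hconst (j - 1)]
  have h1 := key a ha j
  have h2 := key b hb j
  have h3 := hsq j
  have h4 := hsq (j - 1)
  simp only [sub_add_cancel] at h4 ⊢
  push_cast
  linear_combination -x j ^ 2 * h3 - (a j * b (j + 1) - a (j + 1) * b j : R) *
    (a (j + 1) * b (j - 1) - a (j - 1) * b (j + 1)) * (x (j - 1) * x j) * h4 +
    (a j * b (j + 1) - a (j + 1) * b j : R) * (b (j + 1) * h1 - a (j + 1) * h2)

/-- The second-order differential operator `∑ᵢ lᵢ ∂ᵢ² + 2 ∑ᵢ eᵢ ∂ᵢ ∂ᵢ₊₁`, evaluated at the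
origin. -/
noncomputable def secondOrderAtZero {m : ℕ} [NeZero m] (l e : ZMod m → ℤ) :
    MvPolynomial (ZMod m) ℤ →ₗ[ℤ] ℤ :=
  ∑ i, (l i • ((aeval (0 : ZMod m → ℤ)).toLinearMap ∘ₗ
      (pderiv i).toLinearMap ∘ₗ (pderiv i).toLinearMap) +
    (2 * e i) • ((aeval (0 : ZMod m → ℤ)).toLinearMap ∘ₗ
      (pderiv i).toLinearMap ∘ₗ (pderiv (i + 1)).toLinearMap))

theorem secondOrderAtZero_apply {m : ℕ} [NeZero m] (l e : ZMod m → ℤ)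
    (p : MvPolynomial (ZMod m) ℤ) :
    secondOrderAtZero l e p = ∑ i, (l i * aeval (0 : ZMod m → ℤ) (pderiv i (pderiv i p)) +
      2 * e i * aeval (0 : ZMod m → ℤ) (pderiv i (pderiv (i + 1) p))) := by
  simp [secondOrderAtZero]

theorem secondOrderAtZero_mul_X_mul_X {m : ℕ} [NeZero m] (l e : ZMod m → ℤ)
    (p : MvPolynomial (ZMod m) ℤ) {i j : ZMod m} (hij : i ≠ j) (h1 : j - i ≠ 1)
    (h2 : i - j ≠ 1) : secondOrderAtZero l e (p * (X i * X j)) = 0 := by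
  rw [secondOrderAtZero_apply]
  refine Finset.sum_eq_zero fun k _ => ?_
  have h3 : ∀ k, ¬ (i = k ∧ j = k) := by rintro k ⟨rfl, h⟩; exact hij h.symm
  have h4 : ∀ k, ¬ (i = k ∧ j = k + 1) := by
    rintro k ⟨rfl, rfl⟩; simp at h1
  have h5 : ∀ k, ¬ (i = k + 1 ∧ j = k) := by
    rintro k ⟨rfl, rfl⟩; simp at h2
  simp only [Derivation.leibniz, map_add, pderiv_X, Pi.single_apply, smul_eq_mul, map_mul,
    aeval_X, Pi.zero_apply]
  have := h3 k
  have := h4 k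
  have := h5 k
  split_ifs <;> simp_all

theorem secondOrderAtZero_mul_linear {m : ℕ} [NeZero m] (l e c : ZMod m → ℤ)
    (h : ∀ j, c (j - 1) * e (j - 1) + c j * l j + c (j + 1) * e j = 0)
    (p : MvPolynomial (ZMod m) ℤ) :
    secondOrderAtZero l e (p * ∑ j, C (c j) * X j) = 0 := by
  have hd (k : ZMod m) : pderiv k (∑ j, C (c j) * X j) = C (c k) := by
    simp [pderiv_X, Pi.single_apply, Derivation.leibniz]
  have h0 : aeval (0 : ZMod m → ℤ) (∑ j, C (c j) * X j) = 0 := by simp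
  generalize ∑ j, C (c j) * X j = L at hd h0 ⊢
  rw [secondOrderAtZero_apply]
  simp only [Derivation.leibniz, map_add, hd, h0, smul_eq_mul, map_mul, pderiv_C, aeval_C,
    algebraMap_int_eq, Int.coe_castRingHom, Int.cast_id, mul_zero, zero_mul, zero_add]
  set q : ZMod m → ℤ := fun i => aeval (0 : ZMod m → ℤ) (pderiv i p)
  have hshift : ∑ i, q (i + 1) * (c i * e i) = ∑ i, q i * (c (i - 1) * e (i - 1)) :=
    Fintype.sum_equiv (Equiv.addRight (1 : ZMod m)) _ _ fun i => by simp
  have hz : ∑ i, q i * (c (i - 1) * e (i - 1) + c i * l i + c (i + 1) * e i) = 0 :=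
    Finset.sum_eq_zero fun i _ => by rw [h, mul_zero]
  have hz' : ∑ i, q i * (c i * l i + c (i + 1) * e i) + ∑ i, q (i + 1) * (c i * e i) = 0 := by
    rw [hshift, ← Finset.sum_add_distrib, ← hz]
    exact Finset.sum_congr rfl fun i _ => by ring
  refine Eq.trans ?_ (mul_eq_zero_of_right (2 : ℤ) hz')
  rw [← Finset.sum_add_distrib, Finset.mul_sum]
  exact Finset.sum_congr rfl fun i _ => by simp only [q]; ring

theorem secondOrderAtZero_sum_X_sq {m : ℕ} [NeZero m] (hm : 3 ≤ m) (l e : ZMod m → ℤ) :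
    secondOrderAtZero l e (∑ j, X j ^ 2) = 2 * ∑ i, l i := by
  have h1 := ZMod.one_ne_zero_of_three_le hm
  have hd (k : ZMod m) :
      pderiv k (∑ j, X j ^ 2 : MvPolynomial (ZMod m) ℤ) = 2 * X k := by
    simp [pderiv_X, Pi.single_apply, pow_two, Derivation.leibniz, Finset.sum_add_distrib, two_mul]
  rw [secondOrderAtZero_apply, Finset.mul_sum]
  refine Finset.sum_congr rfl fun i _ => ?_
  rw [hd, hd, two_mul, two_mul]
  simp [pderiv_X, h1]
  ring

/-- For a characteristic matrix over the `m`-gon, `∑ⱼ vⱼ²` lies in the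
ideal `I + J` (i.e. `p₁(M(C₂(m),Λ)) = 0`) iff `∑ᵢ lᵢ = 0`. -/
theorem stmt_4 (m : ℕ) [NeZero m] (hm : 3 ≤ m)
    (lam : Fin 2 → ZMod m → ℤ)
    (Δ : ZMod m → ZMod m → ℤ)
    (hΔ : ∀ i j, Δ i j = lam 0 i * lam 1 j - lam 0 j * lam 1 i)
    (l : ZMod m → ℤ)
    (hl : ∀ i, l i = Δ (i - 1) i * Δ i (i + 1) * Δ (i + 1) (i - 1))
    (hns : ∀ i, Δ i (i + 1) = 1 ∨ Δ i (i + 1) = -1) :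
    ((∑ j : ZMod m, (X j : MvPolynomial (ZMod m) ℤ) ^ 2)
        ∈ Ideal.span
          ({p : MvPolynomial (ZMod m) ℤ |
              ∃ i j : ZMod m, i ≠ j ∧ j - i ≠ 1 ∧ i - j ≠ 1 ∧ p = X i * X j}
            ∪ {p : MvPolynomial (ZMod m) ℤ |
                ∃ r : Fin 2, p = ∑ j : ZMod m, C (lam r j) * X j}))
    ↔ (∑ i : ZMod m, l i) = 0 := by
  have hsq (i : ZMod m) : Δ i (i + 1) ^ 2 = 1 := by
    rcases hns i with h | h <;> rw [h] <;> norm_num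
  set S : Set (MvPolynomial (ZMod m) ℤ) :=
    {p | ∃ i j : ZMod m, i ≠ j ∧ j - i ≠ 1 ∧ i - j ≠ 1 ∧ p = X i * X j} ∪
      {p | ∃ r : Fin 2, p = ∑ j : ZMod m, C (lam r j) * X j}
  constructor
  · intro hmem
    have hrel (r : Fin 2) (j : ZMod m) : lam r (j - 1) * Δ (j - 1) (j - 1 + 1) +
        lam r j * l j + lam r (j + 1) * Δ j (j + 1) = 0 := by
      have h1 := hsq (j - 1)
      have h2 := hsq j
      rw [sub_add_cancel] at h1 ⊢
      have h3 : lam r (j - 1) * Δ j (j + 1) + lam r j * Δ (j + 1) (j - 1) +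
          lam r (j + 1) * Δ (j - 1) j = 0 := by
        simp only [hΔ]
        fin_cases r <;> simp only [Fin.zero_eta, Fin.mk_one] <;> ring
      rw [hl]
      linear_combination Δ (j - 1) j * Δ j (j + 1) * h3 - lam r (j - 1) * Δ (j - 1) j * h2 -
        lam r (j + 1) * Δ j (j + 1) * h1
    have hvanish : ∀ q ∈ Ideal.span S, ∀ p,
        secondOrderAtZero l (fun i => Δ i (i + 1)) (p * q) = 0 := by
      intro q hq
      induction hq using Submodule.span_induction with
      | mem q hq =>
        intro p
        rcases hq with ⟨i, j, h1, h2, h3, rfl⟩ | ⟨r, rfl⟩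
        · exact secondOrderAtZero_mul_X_mul_X _ _ p h1 h2 h3
        · exact secondOrderAtZero_mul_linear _ _ _ (hrel r) p
      | zero => simp
      | add q q' _ _ h h' => intro p; rw [mul_add, map_add, h, h', add_zero]
      | smul a q _ h => intro p; rw [smul_eq_mul, ← mul_assoc, h]
    have hzero := hvanish _ hmem 1
    rw [one_mul, secondOrderAtZero_sum_X_sq hm] at hzero
    lia
  · intro hsum
    obtain ⟨w, hw⟩ := exists_sq_eq_intCast_mul hm (lam 0) (lam 1)
      (fun i => by rw [← hΔ, hsq]) (fun j => Ideal.Quotient.mk (Ideal.span S) (X j))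
      (fun i j h1 h2 h3 => by
        rw [← map_mul, Ideal.Quotient.eq_zero_iff_mem]
        exact Ideal.subset_span (Or.inl ⟨i, j, h1, h2, h3, rfl⟩))
      (by
        have := Ideal.Quotient.eq_zero_iff_mem.2
          (Ideal.subset_span (s := S) (Or.inr ⟨0, rfl⟩))
        simpa using this)
      (by
        have := Ideal.Quotient.eq_zero_iff_mem.2
          (Ideal.subset_span (s := S) (Or.inr ⟨1, rfl⟩))
        simpa using this)
    rw [← Ideal.Quotient.eq_zero_iff_mem, map_sum]
    have hl' (j : ZMod m) : Ideal.Quotient.mk (Ideal.span S) (X j ^ 2) = (l j : ℤ) * w := by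
      rw [map_pow, hw, hl]
      simp only [hΔ]
    rw [Finset.sum_congr rfl fun j _ => hl' j, ← Finset.sum_mul, ← Int.cast_sum, hsum]
    simp
end

section
/- Under the stated hypotheses, with all column indices taken cyclically modulo 2k−1 in the set {2,…,2k}: Σ_{i=2}^{2k} [ l_i·(λ_{1,i}² + 1) + 2·Δ_{i,i+1}·λ_{1,i}·λ_{1,i+1} ] ≡ 4 (mod 8). -/
/-- A polynomial representing, modulo 4, a potential for the self-intersection numbers of a
sequence of planar vectors with consecutive determinants `±1`. -/
def rademacherPotential {R : Type*} [CommRing R] (a b c d : R) : R :=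
  2 * a + 2 * c + c * d + 2 * b * c + a * d + a * b + b ^ 2 * c + a * d ^ 2

theorem intCast_rademacherPotential {R : Type*} [CommRing R] (a b c d : ℤ) :
    ((rademacherPotential a b c d : ℤ) : R) = rademacherPotential (a : R) b c d := by
  simp [rademacherPotential]

set_option maxRecDepth 100000 in
set_option maxHeartbeats 4000000 in
theorem rademacherPotential_step_zmod : ∀ a b c d : ZMod 4,
    (a * d - c * b = 1 ∨ a * d - c * b = -1) → ∀ g h : ZMod 4,
    (c * h - g * d = 1 ∨ c * h - g * d = -1) →
    (a * d - c * b) * (c * h - g * d) * (g * b - a * h) - (c * h - g * d) =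
      rademacherPotential c d g h - rademacherPotential a b c d := by
  unfold rademacherPotential
  decide

/-- The step relation for `rademacherPotential` along integer vectors `(a, b)`, `(c, d)`, `(g, h)`
with consecutive determinants `±1`. -/
theorem rademacherPotential_step (a b c d g h : ℤ)
    (h₁ : a * d - c * b = 1 ∨ a * d - c * b = -1)
    (h₂ : c * h - g * d = 1 ∨ c * h - g * d = -1) :
    ∃ w : ℤ, (a * d - c * b) * (c * h - g * d) * (g * b - a * h) =
      (c * h - g * d) + (rademacherPotential c d g h - rademacherPotential a b c d) + 4 * w := by
  have key := rademacherPotential_step_zmod a b c d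
    (h₁.imp (fun h => by exact_mod_cast congrArg (Int.cast : ℤ → ZMod 4) h)
      (fun h => by exact_mod_cast congrArg (Int.cast : ℤ → ZMod 4) h)) g h
    (h₂.imp (fun h => by exact_mod_cast congrArg (Int.cast : ℤ → ZMod 4) h)
      (fun h => by exact_mod_cast congrArg (Int.cast : ℤ → ZMod 4) h))
  simp only [← intCast_rademacherPotential] at key
  have key' : ((((c * h - g * d) + (rademacherPotential c d g h - rademacherPotential a b c d) :
      ℤ)) : ZMod 4) = (((a * d - c * b) * (c * h - g * d) * (g * b - a * h) : ℤ) : ZMod 4) := by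
    push_cast
    linear_combination -key
  obtain ⟨w, hw⟩ := (ZMod.intCast_eq_intCast_iff_dvd_sub _ _ 4).mp key'
  exact ⟨w, by push_cast at hw; linear_combination hw⟩

/-- Three planar vectors with consecutive determinants `e`, `e'` equal to `±1` satisfy
`e v₁ + l v₂ + e' v₃ = 0`, here summed over the two coordinates. -/
theorem three_term_relation (a b c d g h : ℤ)
    (h₁ : a * d - c * b = 1 ∨ a * d - c * b = -1)
    (h₂ : c * h - g * d = 1 ∨ c * h - g * d = -1) :
    (a * d - c * b) * (c * h - g * d) * (g * b - a * h) * (c + d) =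
      -((a * d - c * b) * (a + b) + (c * h - g * d) * (g + h)) := by
  have h₁' : (a * d - c * b) ^ 2 = 1 := by rcases h₁ with h | h <;> simp [h]
  have h₂' : (c * h - g * d) ^ 2 = 1 := by rcases h₂ with h | h <;> simp [h]
  linear_combination (-(c * h - g * d) * (g + h)) * h₁' - (a * d - c * b) * (a + b) * h₂'

/-- Modulo 8, a cyclic term differs from 4 by a telescoping quantity. Here `s₀`, `s`, `s'`
are consecutive values of a kernel vector, and `1 + s + 2 * y` is the entry of the first row. -/
theorem cyclic_term_eq (l e' e s₀ s s' y y' p p' w : ℤ) (he : e = 1 ∨ e = -1)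
    (hs : l * s = -(e' * s₀ + e * s')) (hl : l = e + (p' - p) + 4 * w) :
    ∃ z : ℤ, l * ((1 + s + 2 * y) ^ 2 + 1) + 2 * e * ((1 + s + 2 * y) * (1 + s' + 2 * y')) =
      (e * s * s' + 2 * (e * s * (1 + 2 * y')) + 4 * y' + 2 * p') -
      (e' * s₀ * s + 2 * (e' * s₀ * (1 + 2 * y)) + 4 * y + 2 * p) + 4 + 8 * z := by
  obtain ⟨q, hq⟩ := (Int.even_mul_succ_self y).two_dvd
  obtain ⟨r, hr⟩ : ∃ r, e = 1 + 2 * r := by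
    rcases he with h | h
    · exact ⟨0, by omega⟩
    · exact ⟨-1, by omega⟩
  refine ⟨l * q + e * y * y' + r * (y + y') + y + w + r, ?_⟩
  linear_combination (s + 2 * (1 + 2 * y)) * hs + 4 * l * hq + 2 * hl +
    (4 + 4 * (y + y')) * hr

/-- Around a `(2k−1)`-gonal facet of a spin quasitoric 6-manifold
(columns indexed cyclically with period `2k−1`; residue `c` corresponds to the paper's
column label `c + 2`, so columns 2 and 3 are the residues 0 and 1),
`∑ᵢ [lᵢ(λ₁ᵢ² + 1) + 2Δ_{i,i+1}λ₁ᵢλ₁ᵢ₊₁] ≡ 4 (mod 8)`. -/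
theorem stmt_5 (k : ℕ) (hk : 3 ≤ k)
    (lam : Fin 3 → ZMod (2 * (k - 1) + 1) → ℤ)
    (hcol2 : lam 0 0 = 0 ∧ lam 1 0 = 1 ∧ lam 2 0 = 0)
    (hcol3 : lam 0 1 = 0 ∧ lam 1 1 = 0 ∧ lam 2 1 = 1)
    (Δ : ZMod (2 * (k - 1) + 1) → ZMod (2 * (k - 1) + 1) → ℤ)
    (hΔ : ∀ i j, Δ i j = lam 1 i * lam 2 j - lam 1 j * lam 2 i)
    (l : ZMod (2 * (k - 1) + 1) → ℤ)
    (hl : ∀ i, l i = Δ (i - 1) i * Δ i (i + 1) * Δ (i + 1) (i - 1))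
    (hns : ∀ i, Δ i (i + 1) = 1 ∨ Δ i (i + 1) = -1)
    (hodd : ∀ i, Odd (lam 0 i + lam 1 i + lam 2 i)) :
    (∑ i : ZMod (2 * (k - 1) + 1),
        (l i * (lam 0 i ^ 2 + 1) + 2 * Δ i (i + 1) * (lam 0 i * lam 0 (i + 1))))
      ≡ 4 [ZMOD 8] := by
  have hsub : ∀ i : ZMod (2 * (k - 1) + 1), i - 1 + 1 = i := fun i => sub_add_cancel i 1
  have hy : ∀ i, ∃ y, lam 0 i = 1 + (lam 1 i + lam 2 i) + 2 * y := by
    intro i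
    obtain ⟨m, hm⟩ := hodd i
    exact ⟨m - lam 1 i - lam 2 i, by linear_combination hm⟩
  choose y hy using hy
  let H : ZMod (2 * (k - 1) + 1) → ℤ := fun i =>
    Δ (i - 1) i * (lam 1 (i - 1) + lam 2 (i - 1)) * (lam 1 i + lam 2 i) +
      2 * (Δ (i - 1) i * (lam 1 (i - 1) + lam 2 (i - 1)) * (1 + 2 * y i)) + 4 * y i +
      2 * rademacherPotential (lam 1 (i - 1)) (lam 2 (i - 1)) (lam 1 i) (lam 2 i)
  have hterm : ∀ i, ∃ z : ℤ,
      l i * (lam 0 i ^ 2 + 1) + 2 * Δ i (i + 1) * (lam 0 i * lam 0 (i + 1)) =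
        H (i + 1) - H i + 4 + 8 * z := by
    intro i
    have h₁ : Δ (i - 1) i = 1 ∨ Δ (i - 1) i = -1 := by simpa only [hsub] using hns (i - 1)
    have h₂ := hns i
    have hli := hl i
    have h₁' := h₁
    have h₂' := h₂
    rw [hΔ] at h₁' h₂'
    have hrel := three_term_relation _ _ _ _ _ _ h₁' h₂'
    obtain ⟨w, hw⟩ := rademacherPotential_step _ _ _ _ _ _ h₁' h₂'
    rw [← hΔ, ← hΔ, ← hΔ, ← hli] at hrel hw
    obtain ⟨z, hz⟩ := cyclic_term_eq _ _ _ _ _ _ (y i) (y (i + 1)) _ _ w h₂ hrel hw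
    refine ⟨z, ?_⟩
    simp only [H, add_sub_cancel_right]
    rw [hy i, hy (i + 1), hz]
  choose z hz using hterm
  have hH : ∑ i, H (i + 1) = ∑ i, H i := Equiv.sum_comp (Equiv.addRight 1) H
  have hcard : Fintype.card (ZMod (2 * (k - 1) + 1)) = 2 * (k - 1) + 1 := ZMod.card _
  rw [Finset.sum_congr rfl fun i _ => hz i, Finset.sum_add_distrib, Finset.sum_add_distrib,
    Finset.sum_sub_distrib, hH, sub_self, zero_add, ← Finset.mul_sum, Finset.sum_const,
    Finset.card_univ, hcard, nsmul_eq_mul]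
  refine (Int.modEq_iff_dvd.mpr ⟨-((k - 1 : ℕ) : ℤ) - ∑ i, z i, ?_⟩)
  push_cast
  ring
end

section
/- Under the stated hypotheses (only Δ_{i,i+1} ∈ {1,−1} for every i is needed), with all column indices taken cyclically modulo 2k−1 in the set {2,…,2k}: Σ_{i=2}^{2k} [ l_i·(λ_{2,i}² + λ_{3,i}²) + 2·Δ_{i,i+1}·(λ_{2,i}λ_{2,i+1} + λ_{3,i}λ_{3,i+1}) ] = 0. -/
open Finset

/-- With columns indexed cyclically with period `2k−1` and
`Δ_{i,i+1} ∈ {1,−1}` for every `i` (the only hypothesis needed),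
`∑ᵢ [lᵢ(λ₂ᵢ² + λ₃ᵢ²) + 2Δ_{i,i+1}(λ₂ᵢλ₂ᵢ₊₁ + λ₃ᵢλ₃ᵢ₊₁)] = 0`. -/
theorem stmt_6 (k : ℕ) (hk : 3 ≤ k)
    (lam : Fin 3 → ZMod (2 * (k - 1) + 1) → ℤ)
    (Δ : ZMod (2 * (k - 1) + 1) → ZMod (2 * (k - 1) + 1) → ℤ)
    (hΔ : ∀ i j, Δ i j = lam 1 i * lam 2 j - lam 1 j * lam 2 i)
    (l : ZMod (2 * (k - 1) + 1) → ℤ)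
    (hl : ∀ i, l i = Δ (i - 1) i * Δ i (i + 1) * Δ (i + 1) (i - 1))
    (hns : ∀ i, Δ i (i + 1) = 1 ∨ Δ i (i + 1) = -1) :
    (∑ i : ZMod (2 * (k - 1) + 1),
        (l i * (lam 1 i ^ 2 + lam 2 i ^ 2)
          + 2 * Δ i (i + 1) * (lam 1 i * lam 1 (i + 1) + lam 2 i * lam 2 (i + 1)))) = 0 := by
  set f : ZMod (2 * (k - 1) + 1) → ℤ :=
    fun i => Δ i (i + 1) * (lam 1 i * lam 1 (i + 1) + lam 2 i * lam 2 (i + 1)) with hf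
  have telescoping : ∀ i, l i * (lam 1 i ^ 2 + lam 2 i ^ 2)
      + 2 * Δ i (i + 1) * (lam 1 i * lam 1 (i + 1) + lam 2 i * lam 2 (i + 1))
      = f i - f (i - 1) := by
    intro i
    have hprev : Δ (i - 1) i ^ 2 = 1 := by
      have h := hns (i - 1)
      rw [sub_add_cancel] at h
      exact sq_eq_one_iff.2 h
    have hnext : Δ i (i + 1) ^ 2 = 1 := sq_eq_one_iff.2 (hns i)
    have hlin1 : lam 1 (i - 1) * Δ i (i + 1) + lam 1 i * Δ (i + 1) (i - 1)
        + lam 1 (i + 1) * Δ (i - 1) i = 0 := by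
      simp only [hΔ]; ring
    have hlin2 : lam 2 (i - 1) * Δ i (i + 1) + lam 2 i * Δ (i + 1) (i - 1)
        + lam 2 (i + 1) * Δ (i - 1) i = 0 := by
      simp only [hΔ]; ring
    simp only [hf, hl, sub_add_cancel]
    linear_combination Δ (i - 1) i * Δ i (i + 1) * (lam 1 i * hlin1 + lam 2 i * hlin2)
      - Δ (i - 1) i * (lam 1 (i - 1) * lam 1 i + lam 2 (i - 1) * lam 2 i) * hnext
      - Δ i (i + 1) * (lam 1 i * lam 1 (i + 1) + lam 2 i * lam 2 (i + 1)) * hprev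
  rw [sum_congr rfl fun i _ => telescoping i, sum_sub_distrib, sub_eq_zero]
  exact ((Equiv.subRight 1).sum_comp f).symm
end

section
/- Under the stated hypotheses, setting ρ_i = λ_{1,i}² + λ_{2,i}² + λ_{3,i}² + 1 and ρ_{i,i+1} = 2(λ_{1,i}λ_{1,i+1} + λ_{2,i}λ_{2,i+1} + λ_{3,i}λ_{3,i+1}), one has Σ_{i=2}^{2k} ( l_i·ρ_i + Δ_{i,i+1}·ρ_{i,i+1} ) ≡ 4 (mod 8); in particular this sum is nonzero. (This is the key computation showing that a 3-dimensional simple polytope possessing a facet which is an odd-gon cannot be the orbit polytope of a string quasitoric manifold.) -/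
open Finset

/-- Modulo `4`, the value on the matrix with rows `(a, b)` and `(c, d)` of a polynomial that
restricts to a generator of the characters `SL₂(ℤ/4) → ℤ/4`. -/
def slTwoChar {R : Type*} [CommRing R] (a b c d : R) : R :=
  (1 - c ^ 2) * (b * d - (c - 1) * d + c - 1) + c * (a + d + 1)

/-- The character `slTwoChar` on the pair of rows `(a, b)`, `(c, d)`, the second row being
rescaled by the determinant. -/
def pairChar {R : Type*} [CommRing R] (a b c d : R) : R :=
  slTwoChar a b ((a * d - b * c) * c) ((a * d - b * c) * d)

lemma pairChar_step_zmod : ∀ a b c d : ZMod 4,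
    (a * d - b * c = 1 ∨ a * d - b * c = -1) → ∀ f : ZMod 4, (f = 1 ∨ f = -1) → ∀ l : ZMod 4,
    pairChar c d (-f * (l * c + (a * d - b * c) * a)) (-f * (l * d + (a * d - b * c) * b))
      - pairChar a b c d = l + (a * d - b * c) + 2 := by
  unfold pairChar slTwoChar
  decide +kernel

/-- The three-term relation between consecutive vectors whose determinants are units. -/
lemma three_term {p₁ p₂ q₁ q₂ r₁ r₂ e f l : ℤ} (he : p₁ * q₂ - q₁ * p₂ = e)
    (hf : q₁ * r₂ - r₁ * q₂ = f) (he' : e ^ 2 = 1) (hf' : f ^ 2 = 1)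
    (hl : l = e * f * (r₁ * p₂ - p₁ * r₂)) :
    l * q₁ + e * p₁ + f * r₁ = 0 ∧ l * q₂ + e * p₂ + f * r₂ = 0 := by
  subst hl
  constructor
  · linear_combination (-f * r₁) * he' - e * p₁ * hf' - e * f * r₁ * he - e * f * p₁ * hf
  · linear_combination (-f * r₂) * he' - e * p₂ * hf' - e * f * r₂ * he - e * f * p₂ * hf

lemma pairChar_step {p₁ p₂ q₁ q₂ r₁ r₂ e f l : ℤ} (he : p₁ * q₂ - q₁ * p₂ = e)
    (he' : e = 1 ∨ e = -1) (hf' : f = 1 ∨ f = -1)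
    (h₁ : l * q₁ + e * p₁ + f * r₁ = 0) (h₂ : l * q₂ + e * p₂ + f * r₂ = 0) :
    pairChar q₁ q₂ r₁ r₂ - pairChar p₁ p₂ q₁ q₂ ≡ l + e + 2 [ZMOD 4] := by
  have hff : f * f = 1 := by rcases hf' with rfl | rfl <;> rfl
  have hd : p₁ * q₂ - p₂ * q₁ = e := by linarith
  have hr₁ : r₁ = -f * (l * q₁ + (p₁ * q₂ - p₂ * q₁) * p₁) := by
    rw [hd]; linear_combination f * h₁ - r₁ * hff
  have hr₂ : r₂ = -f * (l * q₂ + (p₁ * q₂ - p₂ * q₁) * p₂) := by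
    rw [hd]; linear_combination f * h₂ - r₂ * hff
  have hunit : ∀ {z : ℤ}, z = 1 ∨ z = -1 → (z : ZMod 4) = 1 ∨ (z : ZMod 4) = -1 := by
    rintro z (rfl | rfl) <;> simp
  have hdet := hunit (hd ▸ he')
  push_cast at hdet
  have key := pairChar_step_zmod p₁ p₂ q₁ q₂ hdet f (hunit hf') l
  refine (ZMod.intCast_eq_intCast_iff _ _ 4).1 ?_
  rw [← hd, hr₁, hr₂]
  unfold pairChar slTwoChar at key ⊢
  push_cast
  exact key

/-- `e * b * c` is determined modulo `4` by a linear expression when all factors are odd. -/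
lemma odd_triple_mul_modEq {e b c : ℤ} (he : Odd e) (hb : Odd b) (hc : Odd c) :
    e * b * c ≡ e + b + c - 2 [ZMOD 4] := by
  obtain ⟨e, rfl⟩ := he
  obtain ⟨b, rfl⟩ := hb
  obtain ⟨c, rfl⟩ := hc
  exact (Int.modEq_iff_dvd.2 ⟨2 * e * b * c + e * b + e * c + b * c, by ring⟩ :
    _ ≡ _ [ZMOD 4]).symm

/-- A cyclic sum of discrete differences vanishes. -/
lemma sum_shift_sub {G M : Type*} [Fintype G] [AddGroup G] [AddCommGroup M] (J : G → M) (g : G) :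
    ∑ i, (J (i + g) - J i) = 0 := by
  rw [sum_sub_distrib, sub_eq_zero]
  exact Equiv.sum_comp (Equiv.addRight g) J

/-- A local form of the congruence: up to a discrete difference, each summand is `4` mod `8`. -/
lemma summand_modEq {p₁ p₂ a x y a' x' y' e f l b b' : ℤ}
    (he : e = 1 ∨ e = -1) (hf : f = 1 ∨ f = -1)
    (hpe : p₁ * y - x * p₂ = e)
    (h₁ : l * x + e * p₁ + f * x' = 0) (h₂ : l * y + e * p₂ + f * y' = 0)
    (hb : a = b + x + y) (hb' : a' = b' + x' + y') (hbo : Odd b) (hbo' : Odd b') :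
    l * (a ^ 2 + x ^ 2 + y ^ 2 + 1) + f * (2 * (a * a' + x * x' + y * y')) ≡
      4 + ((f * (x * (a' + b' + x') + y * (a' + b' + y')) + 2 * pairChar x y x' y' + 2 * b' + 2 * f)
        - (e * (p₁ * (a + b + x) + p₂ * (a + b + y)) + 2 * pairChar p₁ p₂ x y + 2 * b + 2 * e))
      [ZMOD 8] := by
  have hfo : Odd f := by rcases hf with rfl | rfl <;> decide
  have hF := (pairChar_step hpe he hf h₁ h₂).dvd
  have hT := (odd_triple_mul_modEq hfo hbo hbo').dvd
  obtain ⟨s, hs⟩ := hF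
  obtain ⟨t, ht⟩ := hT
  obtain ⟨u, hu⟩ := Int.eight_dvd_sq_sub_one_of_odd hbo
  obtain ⟨m, hm⟩ := hbo
  refine Int.modEq_iff_dvd.2 ⟨-s + t - l * u - m + 1, ?_⟩
  subst hb hb'
  linear_combination (-2) * hs + 2 * ht - l * hu - 4 * hm
    - (2 * b + 2 * x + y) * h₁ - (2 * b + x + 2 * y) * h₂

/-- Around a `(2k−1)`-gonal facet of a spin quasitoric 6-manifold
(columns indexed cyclically with period `2k−1`; residue `c` corresponds to the paper's
column label `c + 2`), setting `ρᵢ = λ₁ᵢ² + λ₂ᵢ² + λ₃ᵢ² + 1` and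
`ρ_{i,i+1} = 2(λ₁ᵢλ₁ᵢ₊₁ + λ₂ᵢλ₂ᵢ₊₁ + λ₃ᵢλ₃ᵢ₊₁)`, one has
`∑ᵢ (lᵢρᵢ + Δ_{i,i+1}ρ_{i,i+1}) ≡ 4 (mod 8)`; in particular this sum is nonzero. -/
theorem stmt_7 (k : ℕ) (hk : 3 ≤ k)
    (lam : Fin 3 → ZMod (2 * (k - 1) + 1) → ℤ)
    (hcol2 : lam 0 0 = 0 ∧ lam 1 0 = 1 ∧ lam 2 0 = 0)
    (hcol3 : lam 0 1 = 0 ∧ lam 1 1 = 0 ∧ lam 2 1 = 1)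
    (Δ : ZMod (2 * (k - 1) + 1) → ZMod (2 * (k - 1) + 1) → ℤ)
    (hΔ : ∀ i j, Δ i j = lam 1 i * lam 2 j - lam 1 j * lam 2 i)
    (l : ZMod (2 * (k - 1) + 1) → ℤ)
    (hl : ∀ i, l i = Δ (i - 1) i * Δ i (i + 1) * Δ (i + 1) (i - 1))
    (hns : ∀ i, Δ i (i + 1) = 1 ∨ Δ i (i + 1) = -1)
    (hodd : ∀ i, Odd (lam 0 i + lam 1 i + lam 2 i))
    (ρ : ZMod (2 * (k - 1) + 1) → ℤ)
    (hρ : ∀ i, ρ i = lam 0 i ^ 2 + lam 1 i ^ 2 + lam 2 i ^ 2 + 1)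
    (ρ₂ : ZMod (2 * (k - 1) + 1) → ZMod (2 * (k - 1) + 1) → ℤ)
    (hρ₂ : ∀ i j, ρ₂ i j = 2 * (lam 0 i * lam 0 j + lam 1 i * lam 1 j + lam 2 i * lam 2 j)) :
    (∑ i : ZMod (2 * (k - 1) + 1), (l i * ρ i + Δ i (i + 1) * ρ₂ i (i + 1))) ≡ 4 [ZMOD 8]
    ∧ (∑ i : ZMod (2 * (k - 1) + 1), (l i * ρ i + Δ i (i + 1) * ρ₂ i (i + 1))) ≠ 0 := by
  have hsq : ∀ {e : ℤ}, e = 1 ∨ e = -1 → e ^ 2 = 1 := fun h => sq_eq_one_iff.2 h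
  have hsub : ∀ i : ZMod (2 * (k - 1) + 1), i - 1 + 1 = i := fun i => sub_add_cancel i 1
  let J : ZMod (2 * (k - 1) + 1) → ℤ := fun i =>
    Δ (i - 1) i * (lam 1 (i - 1) * (lam 0 i + (lam 0 i - lam 1 i - lam 2 i) + lam 1 i)
      + lam 2 (i - 1) * (lam 0 i + (lam 0 i - lam 1 i - lam 2 i) + lam 2 i))
      + 2 * pairChar (lam 1 (i - 1)) (lam 2 (i - 1)) (lam 1 i) (lam 2 i)
      + 2 * (lam 0 i - lam 1 i - lam 2 i) + 2 * Δ (i - 1) i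
  have hb : ∀ i, Odd (lam 0 i - lam 1 i - lam 2 i) := fun i => by
    have := hodd i
    grind
  have hterm : ∀ i, l i * ρ i + Δ i (i + 1) * ρ₂ i (i + 1) ≡ 4 + (J (i + 1) - J i) [ZMOD 8] := by
    intro i
    have he : Δ (i - 1) i = 1 ∨ Δ (i - 1) i = -1 := by simpa only [hsub] using hns (i - 1)
    have h3 := three_term (hΔ (i - 1) i).symm (hΔ i (i + 1)).symm (hsq he) (hsq (hns i))
      ((hl i).trans (by rw [hΔ (i + 1) (i - 1)]))
    rw [hρ, hρ₂]
    simp only [J, add_sub_cancel_right]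
    exact summand_modEq he (hns i) (hΔ (i - 1) i).symm h3.1 h3.2 (by ring) (by ring) (hb i)
      (hb (i + 1))
  have hmod : (∑ i : ZMod (2 * (k - 1) + 1), (l i * ρ i + Δ i (i + 1) * ρ₂ i (i + 1)))
      ≡ 4 [ZMOD 8] := by
    refine (Int.ModEq.sum fun i _ => hterm i).trans ?_
    rw [sum_add_distrib, sum_shift_sub, sum_const, card_univ, ZMod.card]
    refine Int.modEq_iff_dvd.2 ⟨-((k - 1 : ℕ) : ℤ), ?_⟩
    simp only [nsmul_eq_mul]
    push_cast
    ring
  refine ⟨hmod, fun h => ?_⟩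
  rw [h] at hmod
  exact absurd hmod (by decide)
end

section
/- Let n ≥ 1 and let A be an n×n integer matrix every principal minor of which lies in {1,−1}. Then Σ_{j=1}^{2n} v_j² ∈ I + J (equivalently, p₁(M(Iⁿ,Λ)) = 0) if and only if c_{i,j} = 0 for all n+1 ≤ i < j ≤ 2n. -/
open MvPolynomial Finset

/-- The ideal `I` of the cube, generated by the products of opposite facets. -/
noncomputable def facetIdeal (n : ℕ) : Ideal (MvPolynomial (Fin n ⊕ Fin n) ℤ) :=
  Ideal.span {p | ∃ i : Fin n, p = X (Sum.inl i) * X (Sum.inr i)}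

/-- The ideal `J` generated by the linear forms given by the rows of `[Iₙ | A]`. -/
noncomputable def linearIdeal {n : ℕ} (A : Matrix (Fin n) (Fin n) ℤ) :
    Ideal (MvPolynomial (Fin n ⊕ Fin n) ℤ) :=
  Ideal.span {p | ∃ i : Fin n, p = X (Sum.inl i) + ∑ j : Fin n, C (A i j) * X (Sum.inr j)}

/-- A double sum with vanishing diagonal terms, grouped by unordered pairs. -/
lemma sum_sum_eq_zero_of_add_swap_eq_zero {ι B : Type*} [Fintype ι] [LinearOrder ι]
    [AddCommMonoid B] (F : ι → ι → B) (hdiag : ∀ i, F i i = 0)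
    (hF : ∀ i j, i < j → F i j + F j i = 0) : ∑ i, ∑ j, F i j = 0 := by
  have hsplit : ∀ i j, F i j = (if i < j then F i j else 0) + (if j < i then F i j else 0) := by
    intro i j
    rcases lt_trichotomy i j with h | rfl | h
    · simp [h, h.not_gt]
    · simp [hdiag]
    · simp [h, h.not_gt]
  have hswap : ∑ i, ∑ j, (if j < i then F i j else 0) = ∑ i, ∑ j, (if i < j then F j i else 0) :=
    Finset.sum_comm
  calc ∑ i, ∑ j, F i j
      = ∑ i, ∑ j, ((if i < j then F i j else 0) + (if j < i then F i j else 0)) :=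
        Finset.sum_congr rfl fun i _ => Finset.sum_congr rfl fun j _ => hsplit i j
    _ = ∑ i, ∑ j, ((if i < j then F i j else 0) + (if i < j then F j i else 0)) := by
        simp only [Finset.sum_add_distrib, hswap]
    _ = 0 := by
        refine Finset.sum_eq_zero fun i _ => Finset.sum_eq_zero fun j _ => ?_
        split_ifs with h
        · exact hF i j h
        · simp

/-- If all mixed coefficients vanish, `∑ L_k(w)² + ∑ w_k²` is a combination of the
products `w_k L_k(w)`, where `L_k` is the `k`-th row of `A`. -/
lemma sum_sq_eq_of_mixed_coeff_eq_zero {n : ℕ} {B : Type*} [CommRing B]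
    (A : Matrix (Fin n) (Fin n) ℤ) (hA : ∀ i, A i i * A i i = 1) (ρ : Fin n → ℤ)
    (hρ : ∀ i, ρ i = (∑ k, A k i ^ 2) + 1)
    (hc : ∀ i j, i < j →
      -(A i i * A i j) * ρ i - (A j j * A j i) * ρ j + 2 * ∑ k, A k i * A k j = 0)
    (w : Fin n → B) :
    ∑ k, (∑ j, (A k j : B) * w j) ^ 2 + ∑ k, w k ^ 2 =
      ∑ k, ((A k k * ρ k : ℤ) : B) * (w k * ∑ j, (A k j : B) * w j) := by
  let M : Fin n → Fin n → ℤ := fun i j =>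
    ∑ k, A k i * A k j + (if i = j then 1 else 0) - A i i * ρ i * A i j
  have hM : ∑ i, ∑ j, (M i j : B) * (w i * w j) = 0 := by
    apply sum_sum_eq_zero_of_add_swap_eq_zero
    · intro i
      have : M i i = 0 := by
        have h := hρ i
        simp only [pow_two] at h
        simp only [M, if_true, ← h]
        linear_combination (-ρ i) * hA i
      simp [this]
    · intro i j hij
      have : M i j + M j i = 0 := by
        have hcomm : ∑ k, A k j * A k i = ∑ k, A k i * A k j :=
          Finset.sum_congr rfl fun k _ => mul_comm _ _
        simp only [M, hij.ne, hij.ne', if_false, hcomm]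
        linear_combination hc i j hij
      have h : (M i j : B) + M j i = 0 := by exact_mod_cast congrArg (Int.cast : ℤ → B) this
      linear_combination (w i * w j) * h
  have hsq : ∑ k, (∑ j, (A k j : B) * w j) ^ 2 =
      ∑ i, ∑ j, ((∑ k, A k i * A k j : ℤ) : B) * (w i * w j) := by
    simp_rw [pow_two, Finset.sum_mul_sum]
    rw [Finset.sum_comm]
    refine Finset.sum_congr rfl fun i _ => ?_
    rw [Finset.sum_comm]
    refine Finset.sum_congr rfl fun j _ => ?_
    rw [Int.cast_sum, Finset.sum_mul]
    refine Finset.sum_congr rfl fun k _ => ?_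
    push_cast
    ring
  have hdiag : ∑ k, w k ^ 2 = ∑ i, ∑ j, ((if i = j then 1 else 0 : ℤ) : B) * (w i * w j) := by
    simp [pow_two]
  have hrel : ∑ k, ((A k k * ρ k : ℤ) : B) * (w k * ∑ j, (A k j : B) * w j) =
      ∑ i, ∑ j, ((A i i * ρ i * A i j : ℤ) : B) * (w i * w j) := by
    refine Finset.sum_congr rfl fun i _ => ?_
    rw [Finset.mul_sum, Finset.mul_sum]
    refine Finset.sum_congr rfl fun j _ => ?_
    push_cast
    ring
  rw [hsq, hdiag, hrel, ← sub_eq_zero, ← hM, ← Finset.sum_add_distrib, ← Finset.sum_sub_distrib]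
  refine Finset.sum_congr rfl fun i _ => ?_
  rw [← Finset.sum_add_distrib, ← Finset.sum_sub_distrib]
  refine Finset.sum_congr rfl fun j _ => ?_
  simp only [M, Int.cast_add, Int.cast_sub]
  ring

lemma sum_sq_mem_of_mixed_coeff_eq_zero {n : ℕ} (A : Matrix (Fin n) (Fin n) ℤ)
    (hA : ∀ i, A i i * A i i = 1) (ρ : Fin n → ℤ)
    (hρ : ∀ i, ρ i = (∑ k, A k i ^ 2) + 1)
    (hc : ∀ i j, i < j →
      -(A i i * A i j) * ρ i - (A j j * A j i) * ρ j + 2 * ∑ k, A k i * A k j = 0) :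
    (∑ j : Fin n ⊕ Fin n, (X j : MvPolynomial (Fin n ⊕ Fin n) ℤ) ^ 2) ∈
      facetIdeal n ⊔ linearIdeal A := by
  set K := facetIdeal n ⊔ linearIdeal A with hK
  let q := Ideal.Quotient.mk K
  let w : Fin n → MvPolynomial (Fin n ⊕ Fin n) ℤ ⧸ K := fun j => q (X (Sum.inr j))
  have hfacet : ∀ i, q (X (Sum.inl i)) * w i = 0 := by
    intro i
    rw [← map_mul]
    exact Ideal.Quotient.eq_zero_iff_mem.2
      ((le_sup_left : facetIdeal n ≤ K) (Ideal.subset_span ⟨i, rfl⟩))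
  have hlin : ∀ i, q (X (Sum.inl i)) = -∑ j, (A i j : MvPolynomial _ ℤ ⧸ K) * w j := by
    intro i
    have h : q (X (Sum.inl i) + ∑ j : Fin n, C (A i j) * X (Sum.inr j)) = 0 :=
      Ideal.Quotient.eq_zero_iff_mem.2
        ((le_sup_right : linearIdeal A ≤ K) (Ideal.subset_span ⟨i, rfl⟩))
    rw [map_add, map_sum] at h
    simpa [w] using eq_neg_of_add_eq_zero_left h
  rw [← Ideal.Quotient.eq_zero_iff_mem, Fintype.sum_sum_type]
  change q _ = 0
  simp only [map_add, map_sum, map_pow, hlin, neg_sq]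
  change _ + ∑ k, w k ^ 2 = 0
  rw [sum_sq_eq_of_mixed_coeff_eq_zero A hA ρ hρ hc w]
  refine Finset.sum_eq_zero fun k _ => ?_
  have h := hfacet k
  rw [hlin] at h
  linear_combination (-((A k k * ρ k : ℤ) : MvPolynomial (Fin n ⊕ Fin n) ℤ ⧸ K)) * h

/-- Membership of `∑ v_j²` in `I + J` is an identity of integral quadratic forms, seen by
restricting to the lines `t ↦ (-t A x, t x)`. -/
lemma exists_sum_sq_eq_of_mem {n : ℕ} (A : Matrix (Fin n) (Fin n) ℤ)
    (h : (∑ j : Fin n ⊕ Fin n, (X j : MvPolynomial (Fin n ⊕ Fin n) ℤ) ^ 2) ∈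
      facetIdeal n ⊔ linearIdeal A) :
    ∃ g : Fin n → ℤ, ∀ x : Fin n → ℤ,
      ∑ k, (∑ j, A k j * x j) ^ 2 + ∑ k, x k ^ 2 =
        -∑ k, g k * ((∑ j, A k j * x j) * x k) := by
  obtain ⟨p, hp, q, hq, hpq⟩ := Submodule.mem_sup.1 h
  have hset : {p : MvPolynomial (Fin n ⊕ Fin n) ℤ |
      ∃ i : Fin n, p = X (Sum.inl i) * X (Sum.inr i)} =
      Set.range fun i : Fin n => X (Sum.inl i) * X (Sum.inr i) := by
    ext p
    simp [eq_comm]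
  rw [facetIdeal, hset, Ideal.mem_span_range_iff_exists_fun] at hp
  obtain ⟨c, rfl⟩ := hp
  refine ⟨fun k => constantCoeff (c k), fun x => ?_⟩
  obtain ⟨ψ, hψl, hψr, hψC⟩ : ∃ ψ : MvPolynomial (Fin n ⊕ Fin n) ℤ →+* Polynomial ℤ,
      (∀ i, ψ (X (Sum.inl i)) = -(Polynomial.C (∑ j, A i j * x j) * Polynomial.X)) ∧
      (∀ j, ψ (X (Sum.inr j)) = Polynomial.C (x j) * Polynomial.X) ∧
      ∀ a, ψ (C a) = Polynomial.C a :=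
    ⟨eval₂Hom Polynomial.C (Sum.elim (fun i => -(Polynomial.C (∑ j, A i j * x j) * Polynomial.X))
      (fun j => Polynomial.C (x j) * Polynomial.X)),
      fun i => eval₂Hom_X' _ _ _, fun j => eval₂Hom_X' _ _ _, fun a => eval₂Hom_C _ _ _⟩
  have hψq : ψ q = 0 := by
    have hle : linearIdeal A ≤ RingHom.ker ψ := by
      rw [linearIdeal, Ideal.span_le]
      rintro _ ⟨i, rfl⟩
      rw [SetLike.mem_coe, RingHom.mem_ker]
      simp only [map_add, map_sum, map_mul, hψl, hψr, hψC]
      rw [Finset.sum_mul, neg_add_eq_zero]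
      exact Finset.sum_congr rfl fun j _ => by ring
    exact hle hq
  have hconst : ∀ r, (ψ r).eval 0 = constantCoeff r := by
    have hhom : (Polynomial.evalRingHom (0 : ℤ)).comp ψ = constantCoeff := by
      apply MvPolynomial.ringHom_ext
      · simp
      · rintro (i | i) <;> simp [hψl, hψr]
    exact fun r => RingHom.congr_fun hhom r
  have heq := congrArg ψ hpq
  rw [map_add, hψq, add_zero, Fintype.sum_sum_type] at heq
  rw [map_add, map_sum, map_sum, map_sum] at heq
  simp only [map_mul ψ, map_pow ψ, hψl, hψr] at heq
  have hcancel : ∀ a b e : Fin n → Polynomial ℤ,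
      ∑ k, e k * (-(a k * Polynomial.X) * (b k * Polynomial.X)) =
        ∑ k, (-(a k * Polynomial.X)) ^ 2 + ∑ k, (b k * Polynomial.X) ^ 2 →
      ∑ k, a k ^ 2 + ∑ k, b k ^ 2 = -∑ k, e k * (a k * b k) := by
    intro a b e habe
    apply mul_right_cancel₀ (pow_ne_zero 2 (Polynomial.X_ne_zero (R := ℤ)))
    simp only [neg_sq, mul_pow, ← Finset.sum_mul] at habe
    rw [add_mul, ← habe, neg_mul, Finset.sum_mul, ← Finset.sum_neg_distrib]
    exact Finset.sum_congr rfl fun k _ => by ring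
  have h0 := congrArg (Polynomial.eval 0) (hcancel (fun k => Polynomial.C (∑ j, A k j * x j))
    (fun k => Polynomial.C (x k)) (fun k => ψ (c k)) heq)
  simpa only [Polynomial.eval_add, Polynomial.eval_neg, Polynomial.eval_finsetSum,
    Polynomial.eval_mul, Polynomial.eval_pow, Polynomial.eval_C, hconst] using h0

lemma mixed_coeff_eq_zero_of_sum_sq_eq {n : ℕ} (A : Matrix (Fin n) (Fin n) ℤ)
    (hA : ∀ i, A i i * A i i = 1) (ρ : Fin n → ℤ)
    (hρ : ∀ i, ρ i = (∑ k, A k i ^ 2) + 1) (g : Fin n → ℤ)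
    (hg : ∀ x : Fin n → ℤ, ∑ k, (∑ j, A k j * x j) ^ 2 + ∑ k, x k ^ 2 =
      -∑ k, g k * ((∑ j, A k j * x j) * x k)) {i j : Fin n} (hij : i ≠ j) :
    -(A i i * A i j) * ρ i - (A j j * A j i) * ρ j + 2 * ∑ k, A k i * A k j = 0 := by
  have hsingle : ∀ i, g i = -(A i i * ρ i) := by
    intro i
    have h := hg (Pi.single i 1)
    simp [Pi.single_apply, ← hρ] at h
    linear_combination (-g i) * hA i + A i i * h
  have h := hg (Pi.single i 1 + Pi.single j 1)
  have hx : ∑ k, (Pi.single i 1 + Pi.single j 1 : Fin n → ℤ) k ^ 2 = 2 := by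
    simp [Pi.single_apply, add_sq, Finset.sum_add_distrib, hij.symm]
  have hsq : ∑ k, (A k i + A k j) ^ 2 =
      ∑ k, A k i ^ 2 + 2 * ∑ k, A k i * A k j + ∑ k, A k j ^ 2 := by
    rw [Finset.mul_sum, ← Finset.sum_add_distrib, ← Finset.sum_add_distrib]
    exact Finset.sum_congr rfl fun k _ => by ring
  rw [hx] at h
  simp [Pi.single_apply, mul_add, Finset.sum_add_distrib, hsq, hsingle] at h
  linear_combination h + hρ i + hρ j + ρ i * hA i + ρ j * hA j

/-- For `Λ = [Iₙ | A]` over the `n`-cube with all principal minors of `A`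
in `{1,−1}`, `∑ⱼ vⱼ²` lies in `I + J` (i.e. `p₁(M(Iⁿ,Λ)) = 0`) iff all coefficients
`c_{i,j}` vanish. -/
theorem stmt_11 (n : ℕ) (hn : 1 ≤ n) (A : Matrix (Fin n) (Fin n) ℤ)
    (hminor : ∀ S : Finset (Fin n), S.Nonempty →
      (A.submatrix (fun i : {x : Fin n // x ∈ S} => i.1)
          (fun j : {x : Fin n // x ∈ S} => j.1)).det = 1 ∨
      (A.submatrix (fun i : {x : Fin n // x ∈ S} => i.1)
          (fun j : {x : Fin n // x ∈ S} => j.1)).det = -1)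
    (ρ : Fin n → ℤ) (hρ : ∀ i, ρ i = (∑ k, A k i ^ 2) + 1)
    (ρ₂ : Fin n → Fin n → ℤ) (hρ₂ : ∀ i j, ρ₂ i j = 2 * ∑ k, A k i * A k j)
    (c : Fin n → Fin n → ℤ)
    (hc : ∀ i j, c i j = -(A i i * A i j) * ρ i - (A j j * A j i) * ρ j + ρ₂ i j) :
    ((∑ j : Fin n ⊕ Fin n, (X j : MvPolynomial (Fin n ⊕ Fin n) ℤ) ^ 2)
        ∈ Ideal.span
          ({p : MvPolynomial (Fin n ⊕ Fin n) ℤ |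
              ∃ i : Fin n, p = X (Sum.inl i) * X (Sum.inr i)}
            ∪ {p : MvPolynomial (Fin n ⊕ Fin n) ℤ |
                ∃ i : Fin n,
                  p = X (Sum.inl i) + ∑ j : Fin n, C (A i j) * X (Sum.inr j)}))
    ↔ ∀ i j : Fin n, i < j → c i j = 0 := by
  have hA : ∀ i, A i i * A i i = 1 := by
    intro i
    have hdet : (A.submatrix (fun k : {x : Fin n // x ∈ ({i} : Finset (Fin n))} => k.1)
        (fun k : {x : Fin n // x ∈ ({i} : Finset (Fin n))} => k.1)).det = A i i := by
      have : Unique {x : Fin n // x ∈ ({i} : Finset (Fin n))} :=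
        ⟨⟨⟨i, Finset.mem_singleton_self i⟩⟩, fun y => Subtype.ext (Finset.mem_singleton.1 y.2)⟩
      rw [Matrix.det_unique, Matrix.submatrix_apply,
        Finset.mem_singleton.1 (default : {x : Fin n // x ∈ ({i} : Finset (Fin n))}).2]
    have h := hminor {i} (Finset.singleton_nonempty i)
    rw [hdet] at h
    rcases h with h | h <;> simp [h]
  rw [Ideal.span_union]
  constructor
  · intro h i j hij
    obtain ⟨g, hg⟩ := exists_sum_sq_eq_of_mem A h
    rw [hc, hρ₂]
    exact mixed_coeff_eq_zero_of_sum_sq_eq A hA ρ hρ g hg hij.ne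
  · intro h
    refine sum_sq_mem_of_mixed_coeff_eq_zero A hA ρ hρ fun i j hij => ?_
    rw [← hρ₂, ← hc]
    exact h i j hij
end

section
/- Let n ≥ 1 and let A = (A_{i,j}) be an n×n integer matrix such that: (i) A_{i,i} = 1 for every i; (ii) every principal minor of A lies in {1,−1}; and (iii) for all i ≠ j, A_{i,j}·ρ_i + A_{j,i}·ρ_j = 2·Σ_{k=1}^n A_{k,i}A_{k,j}, where ρ_i = Σ_{k=1}^n A_{k,i}² + 1. Then every principal minor of A equals 1. (Combined with Dobrinskaya's criterion, this is the core of the theorem that every string quasitoric manifold over the cube Iⁿ is weakly equivariantly homeomorphic to a Bott manifold.) -/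
open scoped Matrix in
/-- A real square matrix whose quadratic form is positive definite has positive determinant,
even if the matrix is not symmetric. -/
theorem Matrix.det_pos_of_forall_dotProduct_mulVec_pos {ι : Type*} [Fintype ι] [DecidableEq ι]
    (M : Matrix ι ι ℝ) (hM : ∀ x : ι → ℝ, x ≠ 0 → 0 < x ⬝ᵥ (M *ᵥ x)) : 0 < M.det := by
  by_contra! hdet
  let f : ℝ → ℝ := fun t => (t • M + (1 - t) • (1 : Matrix ι ι ℝ)).det
  have hf : Continuous f := by fun_prop
  have hmem : (0 : ℝ) ∈ Set.Icc (f 1) (f 0) := by simp [f, hdet]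
  obtain ⟨t, ⟨ht0, ht1⟩, ht⟩ := intermediate_value_Icc' zero_le_one hf.continuousOn hmem
  obtain ⟨x, hx, hx0⟩ := Matrix.exists_mulVec_eq_zero_iff.mpr ht
  have hquad : t * (x ⬝ᵥ (M *ᵥ x)) + (1 - t) * (x ⬝ᵥ x) = 0 := by
    simpa [Matrix.add_mulVec, Matrix.smul_mulVec, dotProduct_add, dotProduct_smul]
      using congrArg (x ⬝ᵥ ·) hx0
  have hMx := hM x hx
  have hxx : 0 < x ⬝ᵥ x :=
    lt_of_le_of_ne (Finset.sum_nonneg fun i _ => mul_self_nonneg (x i))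
      fun h => hx (dotProduct_self_eq_zero.mp h.symm)
  rcases ht0.eq_or_lt with rfl | htpos
  · linarith
  · nlinarith [mul_pos htpos hMx, mul_nonneg (sub_nonneg.mpr ht1) hxx.le]

open scoped Matrix in
/-- If `D B + Bᵀ D = 2 (Cᵀ C + 1)` for a diagonal matrix `D` with positive entries, then
`B` has positive determinant. -/
theorem Matrix.det_pos_of_diagonal_mul_add_transpose_mul {ι κ : Type*} [Fintype ι] [DecidableEq ι]
    [Fintype κ] (B : Matrix ι ι ℝ) (C : Matrix κ ι ℝ) (d : ι → ℝ) (hd : ∀ i, 0 < d i)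
    (h : Matrix.diagonal d * B + (Matrix.diagonal d * B).transpose
      = (2 : ℝ) • (C.transpose * C + 1)) : 0 < B.det := by
  have hpos : 0 < (Matrix.diagonal d * B).det := by
    refine Matrix.det_pos_of_forall_dotProduct_mulVec_pos _ fun x hx => ?_
    have hquad := congrArg (fun N : Matrix ι ι ℝ => x ⬝ᵥ (N *ᵥ x)) h
    have hsymm : x ⬝ᵥ ((Matrix.diagonal d * B).transpose *ᵥ x)
        = x ⬝ᵥ ((Matrix.diagonal d * B) *ᵥ x) := by
      rw [Matrix.mulVec_transpose, dotProduct_comm, ← Matrix.dotProduct_mulVec]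
    have hgram : x ⬝ᵥ ((C.transpose * C) *ᵥ x) = (C *ᵥ x) ⬝ᵥ (C *ᵥ x) := by
      rw [← Matrix.mulVec_mulVec, Matrix.dotProduct_mulVec, Matrix.vecMul_transpose]
    simp only [Matrix.add_mulVec, Matrix.smul_mulVec, dotProduct_add, dotProduct_smul,
      Matrix.one_mulVec, smul_eq_mul, hsymm, hgram] at hquad
    have hCx : 0 ≤ (C *ᵥ x) ⬝ᵥ (C *ᵥ x) := Finset.sum_nonneg fun i _ => mul_self_nonneg _
    have hxx : 0 < x ⬝ᵥ x :=
      lt_of_le_of_ne (Finset.sum_nonneg fun i _ => mul_self_nonneg (x i))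
        fun h => hx (dotProduct_self_eq_zero.mp h.symm)
    linarith
  rw [Matrix.det_mul, Matrix.det_diagonal] at hpos
  exact (pos_iff_pos_of_mul_pos hpos).mp (Finset.prod_pos fun i _ => hd i)

/-- If `A` is an `n × n` integer matrix with unit diagonal, all principal
minors in `{1,−1}`, and satisfying the string relations
`A_{i,j}ρᵢ + A_{j,i}ρⱼ = 2∑ₖ A_{k,i}A_{k,j}` for `i ≠ j`, then every principal minor
of `A` equals `1`. -/
theorem stmt_12 (n : ℕ) (hn : 1 ≤ n) (A : Matrix (Fin n) (Fin n) ℤ)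
    (hdiag : ∀ i, A i i = 1)
    (hminor : ∀ S : Finset (Fin n), S.Nonempty →
      (A.submatrix (fun i : {x : Fin n // x ∈ S} => i.1)
          (fun j : {x : Fin n // x ∈ S} => j.1)).det = 1 ∨
      (A.submatrix (fun i : {x : Fin n // x ∈ S} => i.1)
          (fun j : {x : Fin n // x ∈ S} => j.1)).det = -1)
    (ρ : Fin n → ℤ) (hρ : ∀ i, ρ i = (∑ k, A k i ^ 2) + 1)
    (hstring : ∀ i j : Fin n, i ≠ j →
      A i j * ρ i + A j i * ρ j = 2 * ∑ k, A k i * A k j) :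
    ∀ S : Finset (Fin n), S.Nonempty →
      (A.submatrix (fun i : {x : Fin n // x ∈ S} => i.1)
          (fun j : {x : Fin n // x ∈ S} => j.1)).det = 1 := by
  intro S hS
  let C : Matrix (Fin n) {x : Fin n // x ∈ S} ℝ := Matrix.of fun k j => (A k j.1 : ℝ)
  let B := A.submatrix (fun i : {x : Fin n // x ∈ S} => i.1)
    (fun j : {x : Fin n // x ∈ S} => j.1)
  have hpos : 0 < (B.map (Int.castRingHom ℝ)).det := by
    refine Matrix.det_pos_of_diagonal_mul_add_transpose_mul _ C (fun i => (ρ i.1 : ℝ))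
      (fun i => ?_) ?_
    · have : 0 ≤ ∑ k, A k i.1 ^ 2 := Finset.sum_nonneg fun k _ => sq_nonneg _
      have : 0 < ρ i.1 := by rw [hρ]; lia
      exact_mod_cast this
    · ext i j
      have key : ρ i.1 * A i.1 j.1 + ρ j.1 * A j.1 i.1
          = 2 * ((∑ k, A k i.1 * A k j.1) + if i = j then 1 else 0) := by
        by_cases hij : i = j
        · subst hij
          simp only [hdiag, hρ, sq, if_true]
          ring
        · rw [if_neg hij, add_zero, ← hstring i.1 j.1 fun h => hij (Subtype.ext h)]
          ring
      simp only [Matrix.add_apply, Matrix.transpose_apply, Matrix.diagonal_mul, Matrix.map_apply,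
        Matrix.smul_apply, Matrix.one_apply, smul_eq_mul, B, Matrix.submatrix_apply, eq_intCast]
      simp only [Matrix.mul_apply, Matrix.transpose_apply, C, Matrix.of_apply]
      exact_mod_cast key
  rw [← RingHom.mapMatrix_apply, ← RingHom.map_det, eq_intCast, Int.cast_pos] at hpos
  rcases hminor S hS with h | h
  · exact h
  · exact absurd hpos (by rw [h]; decide)
end
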